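/- arXiv:2502.02484 — 13 statements merged into one kernel-verified Lean document; each statement's English description precedes it below -/
import Mathlib

section
/- Let R be a commutative ring. An element x ∈ R is absolute (i.e., f(x) = g(x) for any two ring homomorphisms f, g : R → S into any ring S) if and only if x ⊗ 1 = 1 ⊗ x in R ⊗_ℤ R. -/
open scoped TensorProduct

/-- An element `x` of a commutative ring `R` is absolute (`f x = g x` for any two
ring homomorphisms `f, g : R → S` into any ring `S`) if and only if `x ⊗ 1 = 1 ⊗ x`
in `R ⊗_ℤ R`. -/
theorem absolute_iff_tmul_eq (R : Type) [CommRing R] (x : R) :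
    (∀ (S : Type) [CommRing S] (f g : R →+* S), f x = g x) ↔
      (x ⊗ₜ[ℤ] (1 : R) : R ⊗[ℤ] R) = (1 : R) ⊗ₜ[ℤ] x := by
  constructor
  · intro h
    exact h (R ⊗[ℤ] R) Algebra.TensorProduct.includeLeftRingHom
      (Algebra.TensorProduct.includeRight (R := ℤ) (A := R) (B := R)).toRingHom
  · intro h S _ f g
    have key := congrArg
      (Algebra.TensorProduct.productMap f.toIntAlgHom g.toIntAlgHom) h
    simpa using key
end

section
/- Let A and B be disjoint sets of prime numbers, and let m, n be positive integers such that every prime factor of m lies in A and every prime factor of n lies in B. Then the tensor product (ℤ[A⁻¹] × ℤ/mℤ) ⊗_ℤ (ℤ[B⁻¹] × ℤ/nℤ) is isomorphic as a ring to ℤ[(A ∪ B)⁻¹] × ℤ/mnℤ. -/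
open scoped TensorProduct

namespace IsLocalization

variable {R : Type*} [CommRing R] (M N : Submonoid R)
  (S T U : Type*) [CommRing S] [CommRing T] [CommRing U] [Algebra R S] [Algebra R T] [Algebra R U]

/-- The tensor product of the localizations of `R` at `M` and at `N` is the localization of `R`
at `M ⊔ N`. -/
noncomputable def tensorEquivSup [IsLocalization M S] [IsLocalization N T]
    [IsLocalization (M ⊔ N) U] : S ⊗[R] T ≃ₐ[R] U :=
  have hU (y : (M ⊔ N : Submonoid R)) : IsUnit (algebraMap R (S ⊗[R] T) y) := by
    suffices h : M ⊔ N ≤ (IsUnit.submonoid (S ⊗[R] T)).comap (algebraMap R (S ⊗[R] T)) from h y.2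
    refine sup_le (fun x hx ↦ ?_) (fun x hx ↦ ?_)
    · have h := (map_units S (⟨x, hx⟩ : M)).map
        (Algebra.TensorProduct.includeLeft : S →ₐ[R] S ⊗[R] T)
      rwa [AlgHom.commutes] at h
    · have h := (map_units T (⟨x, hx⟩ : N)).map
        (Algebra.TensorProduct.includeRight : T →ₐ[R] S ⊗[R] T)
      rwa [AlgHom.commutes] at h
  have hM (y : M) : IsUnit (Algebra.ofId R U y) :=
    map_units U (⟨y, le_sup_left (a := M) y.2⟩ : (M ⊔ N : Submonoid R))
  have hN (y : N) : IsUnit (Algebra.ofId R U y) :=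
    map_units U (⟨y, le_sup_right (b := N) y.2⟩ : (M ⊔ N : Submonoid R))
  have : Subsingleton (U →ₐ[R] U) := algHom_subsingleton (M ⊔ N)
  have : Subsingleton (S →ₐ[R] S ⊗[R] T) := algHom_subsingleton M
  have : Subsingleton (T →ₐ[R] S ⊗[R] T) := algHom_subsingleton N
  AlgEquiv.ofAlgHom
    (Algebra.TensorProduct.lift (liftAlgHom (M := M) (S := S) (f := Algebra.ofId R U) hM)
      (liftAlgHom (M := N) (S := T) (f := Algebra.ofId R U) hN) fun _ _ ↦ Commute.all _ _)
    (liftAlgHom (M := M ⊔ N) (S := U) (f := Algebra.ofId R (S ⊗[R] T)) hU)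
    (Subsingleton.elim _ _)
    (Algebra.TensorProduct.ext (Subsingleton.elim _ _) (Subsingleton.elim _ _))

/-- If `M` already acts invertibly on the algebra `S`, then tensoring `S` with the localization
of `R` at `M` does nothing. -/
noncomputable def tensorEquivOfIsUnit [IsLocalization M T]
    (h : ∀ x ∈ M, IsUnit (algebraMap R S x)) : S ⊗[R] T ≃ₐ[S] S :=
  (atUnits S (Algebra.algebraMapSubmonoid S M) (S := S ⊗[R] T) <| by
    rintro _ ⟨x, hx, rfl⟩
    exact h x hx).symm

end IsLocalization

theorem ZMod.subsingleton_tensorProduct {m n : ℕ} (h : m.Coprime n) :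
    Subsingleton (ZMod m ⊗[ℤ] ZMod n) := by
  refine subsingleton_of_zero_eq_one ?_
  obtain ⟨a, b, hab⟩ := Nat.isCoprime_iff_coprime.mpr h
  have hm : ((m : ℤ) : ZMod m ⊗[ℤ] ZMod n) = 0 := by
    simpa using (map_natCast
      (Algebra.TensorProduct.includeLeft : ZMod m →ₐ[ℤ] ZMod m ⊗[ℤ] ZMod n) m).symm
  have hn : ((n : ℤ) : ZMod m ⊗[ℤ] ZMod n) = 0 := by
    simpa using (map_natCast
      (Algebra.TensorProduct.includeRight : ZMod n →ₐ[ℤ] ZMod m ⊗[ℤ] ZMod n) n).symm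
  have := congrArg (Int.cast : ℤ → ZMod m ⊗[ℤ] ZMod n) hab
  push_cast at this hm hn
  simpa [hm, hn] using this

/-- The multiplicative submonoid of `ℤ` generated by a set of natural numbers. -/
abbrev Int.closureNatCast (A : Set ℕ) : Submonoid ℤ :=
  Submonoid.closure ((fun p : ℕ => (p : ℤ)) '' A)

theorem ZMod.isUnit_algebraMap_of_mem_closure {A : Set ℕ} {n : ℕ} (h : ∀ p ∈ A, p.Coprime n) :
    ∀ x ∈ Int.closureNatCast A, IsUnit (algebraMap ℤ (ZMod n) x) := by
  suffices H : Int.closureNatCast A ≤ (IsUnit.submonoid (ZMod n)).comap (algebraMap ℤ (ZMod n))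
    from fun x hx ↦ H hx
  rw [Submonoid.closure_le]
  rintro _ ⟨p, hp, rfl⟩
  simpa [IsUnit.mem_submonoid_iff] using (ZMod.isUnit_iff_coprime p n).mpr (h p hp)

namespace Algebra.TensorProduct

variable (R A B C D : Type*) [CommRing R] [CommRing A] [CommRing B] [CommRing C] [CommRing D]
  [Algebra R A] [Algebra R B] [Algebra R C] [Algebra R D]

/-- Tensor product of algebras commutes with binary products on the left. -/
noncomputable def prodLeft : (A × B) ⊗[R] C ≃ₐ[R] (A ⊗[R] C) × (B ⊗[R] C) :=
  (Algebra.TensorProduct.comm R (A × B) C).trans <|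
    (prodRight R R C A B).trans <|
      AlgEquiv.prodCongr (Algebra.TensorProduct.comm R C A) (Algebra.TensorProduct.comm R C B)

/-- Tensor product of algebras distributes over binary products in both arguments. -/
noncomputable def prodProd :
    (A × B) ⊗[R] (C × D) ≃ₐ[R] ((A ⊗[R] C) × (B ⊗[R] C)) × ((A ⊗[R] D) × (B ⊗[R] D)) :=
  (prodRight R R (A × B) C D).trans <| AlgEquiv.prodCongr (prodLeft R A B C) (prodLeft R A B D)

end Algebra.TensorProduct

/-- Associativity of the product of rings. -/
def RingEquiv.prodAssoc (R S T : Type*) [CommRing R] [CommRing S] [CommRing T] :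
    (R × S) × T ≃+* R × (S × T) :=
  { Equiv.prodAssoc R S T with
    map_mul' := fun _ _ ↦ rfl
    map_add' := fun _ _ ↦ rfl }

theorem Algebra.TensorProduct.nonempty_ringEquiv_of_algebra_eq {R X Y Z : Type*} [CommRing R]
    [CommRing X] [CommRing Y] [CommRing Z] {i i' : Algebra R X} {j j' : Algebra R Y}
    (hi : i = i') (hj : j = j') (h : letI := i; letI := j; Nonempty (X ⊗[R] Y ≃+* Z)) :
    letI := i'; letI := j'; Nonempty (X ⊗[R] Y ≃+* Z) := by
  subst hi hj
  exact h

/-- Let `A` and `B` be disjoint sets of primes and `m`, `n` positive integers with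
every prime factor of `m` in `A` and every prime factor of `n` in `B`. Then
`(ℤ[A⁻¹] × ℤ/mℤ) ⊗_ℤ (ℤ[B⁻¹] × ℤ/nℤ) ≅ ℤ[(A ∪ B)⁻¹] × ℤ/mnℤ` as rings. -/
theorem tensor_type_three_solid (A B : Set ℕ)
    (hA : ∀ p ∈ A, p.Prime) (hB : ∀ p ∈ B, p.Prime) (hAB : Disjoint A B)
    (m n : ℕ) (hm : 0 < m) (hn : 0 < n)
    (hmA : ∀ p : ℕ, p.Prime → p ∣ m → p ∈ A) (hnB : ∀ p : ℕ, p.Prime → p ∣ n → p ∈ B) :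
    Nonempty
      (((Localization (Submonoid.closure ((fun p : ℕ => (p : ℤ)) '' A)) × ZMod m) ⊗[ℤ]
          (Localization (Submonoid.closure ((fun p : ℕ => (p : ℤ)) '' B)) × ZMod n)) ≃+*
        (Localization (Submonoid.closure ((fun p : ℕ => (p : ℤ)) '' (A ∪ B))) ×
          ZMod (m * n))) := by
  have hAn : ∀ p ∈ A, p.Coprime n := fun p hp ↦ (hA p hp).coprime_iff_not_dvd.mpr fun hd ↦
    Set.disjoint_left.mp hAB hp (hnB p (hA p hp) hd)
  have hBm : ∀ p ∈ B, p.Coprime m := fun p hp ↦ (hB p hp).coprime_iff_not_dvd.mpr fun hd ↦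
    Set.disjoint_left.mp hAB (hmA p (hB p hp) hd) hp
  have hmn : m.Coprime n := Nat.coprime_of_dvd fun p hp hpm ↦
    (hp.coprime_iff_not_dvd.mp (hAn p (hmA p hp hpm)))
  have hsup : IsLocalization (Int.closureNatCast A ⊔ Int.closureNatCast B)
      (Localization (Int.closureNatCast (A ∪ B))) := by
    rw [← Submonoid.closure_union, ← Set.image_union]
    exact Localization.isLocalization
  have : Subsingleton (ZMod m ⊗[ℤ] ZMod n) := ZMod.subsingleton_tensorProduct hmn
  have : Unique (ZMod m ⊗[ℤ] ZMod n) := Unique.mk' _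
  let eAB := (IsLocalization.tensorEquivSup (Int.closureNatCast A) (Int.closureNatCast B)
    (Localization (Int.closureNatCast A)) (Localization (Int.closureNatCast B))
    (Localization (Int.closureNatCast (A ∪ B)))).toRingEquiv
  let em := (IsLocalization.tensorEquivOfIsUnit (Int.closureNatCast B) (ZMod m)
    (Localization (Int.closureNatCast B)) (ZMod.isUnit_algebraMap_of_mem_closure hBm)).toRingEquiv
  let en := (Algebra.TensorProduct.comm ℤ (Localization (Int.closureNatCast A))
    (ZMod n)).toRingEquiv.trans (IsLocalization.tensorEquivOfIsUnit (Int.closureNatCast A) (ZMod n)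
    (Localization (Int.closureNatCast A)) (ZMod.isUnit_algebraMap_of_mem_closure hAn)).toRingEquiv
  let e := (Algebra.TensorProduct.prodProd ℤ (Localization (Int.closureNatCast A)) (ZMod m)
    (Localization (Int.closureNatCast B)) (ZMod n)).toRingEquiv
  refine Algebra.TensorProduct.nonempty_ringEquiv_of_algebra_eq
    (i := Prod.algebra _ _ _) (j := Prod.algebra _ _ _)
    (i' := Ring.toIntAlgebra _) (j' := Ring.toIntAlgebra _)
    (Subsingleton.elim _ _) (Subsingleton.elim _ _) ?_
  exact ⟨e.trans <| (RingEquiv.prodCongr (RingEquiv.prodCongr eAB em)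
    ((RingEquiv.prodZeroRing _ _).symm.trans en)).trans <| (RingEquiv.prodAssoc _ _ _).trans <|
      RingEquiv.prodCongr (.refl _) (ZMod.chineseRemainder hmn).symm⟩
end

section
/- Let R be a commutative ring, p a prime number, and a a nonnegative integer. There exists a ring homomorphism ℤ[1/p] × ℤ/p^aℤ → R if and only if there exists an element r ∈ R satisfying p·r² = r and p^(a+1)·r = p^a (where integers are interpreted in R via the unique map ℤ → R). -/
/-- There is a ring homomorphism `ZMod n →+* R` as soon as `n = 0` in `R`. -/
theorem ZMod.nonempty_ringHom_of_natCast_eq_zero {R : Type*} [CommRing R] {n : ℕ}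
    (h : (n : R) = 0) : Nonempty (ZMod n →+* R) := by
  refine ⟨(Ideal.Quotient.lift (Ideal.span {(n : ℤ)}) (Int.castRingHom R) ?_).comp
    (Int.quotientSpanNatEquivZMod n).symm.toRingHom⟩
  intro x hx
  obtain ⟨y, rfl⟩ := Ideal.mem_span_singleton.mp hx
  simp [h]

/-- For an idempotent `e`, homomorphisms to `R ⧸ (1 - e)` and `R ⧸ (e)` glue to a homomorphism
from the product to `R`. -/
theorem IsIdempotentElem.nonempty_prod_ringHom {A B R : Type*} [CommRing A] [CommRing B]
    [CommRing R] {e : R} (he : IsIdempotentElem e) (f : A →+* R ⧸ Ideal.span {1 - e})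
    (g : B →+* R ⧸ Ideal.span {e}) : Nonempty (A × B →+* R) := by
  have hcop : IsCoprime (Ideal.span {1 - e}) (Ideal.span {e}) :=
    (Ideal.isCoprime_span_singleton_iff _ _).mpr ⟨1, 1, by ring⟩
  have hbot : Ideal.span {1 - e} ⊓ Ideal.span {e} = ⊥ := by
    rw [eq_bot_iff]
    rintro x ⟨hx, hx'⟩
    obtain ⟨u, hu⟩ := Ideal.mem_span_singleton.mp hx
    obtain ⟨v, hv⟩ := Ideal.mem_span_singleton.mp hx'
    rw [Ideal.mem_bot]
    have h : e * e = e := he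
    linear_combination e * hu + (1 - e) * hv - (u + v) * h
  exact ⟨((Ideal.quotEquivOfEq hbot).trans (RingEquiv.quotientBot R)).toRingHom.comp
    ((Ideal.quotientInfEquivQuotientProd _ _ hcop).symm.toRingHom.comp (f.prodMap g))⟩

/-- For a commutative ring `R`, a prime `p` and `a ≥ 0`, there exists a ring
homomorphism `ℤ[1/p] × ℤ/p^aℤ → R` if and only if there exists `r ∈ R` with `p * r ^ 2 = r`
and `p ^ (a + 1) * r = p ^ a`. -/
theorem exists_basic_hom_iff (R : Type) [CommRing R] (p : ℕ) (hp : p.Prime) (a : ℕ) :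
    Nonempty ((Localization.Away (p : ℤ) × ZMod (p ^ a)) →+* R) ↔
      ∃ r : R, (p : R) * r ^ 2 = r ∧ (p : R) ^ (a + 1) * r = (p : R) ^ a := by
  constructor
  · rintro ⟨f⟩
    obtain ⟨s, hs⟩ : ∃ s : Localization.Away (p : ℤ), (p : Localization.Away (p : ℤ)) * s = 1 := by
      have h := IsLocalization.Away.algebraMap_isUnit (S := Localization.Away (p : ℤ)) (p : ℤ)
      simpa using h.exists_right_inv
    have hz : (p : ZMod (p ^ a)) ^ a = 0 := by
      exact_mod_cast ZMod.natCast_self (p ^ a)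
    refine ⟨f (s, 0), ?_, ?_⟩
    · rw [← map_natCast f, ← map_pow, ← map_mul]
      congr 1
      ext
      · simp only [Prod.fst_mul, Prod.fst_natCast, Prod.pow_fst]
        linear_combination s * hs
      · simp
    · rw [← map_natCast f, ← map_pow, ← map_pow, ← map_mul]
      congr 1
      ext
      · simp only [Prod.fst_mul, Prod.fst_natCast, Prod.pow_fst]
        linear_combination (p : Localization.Away (p : ℤ)) ^ a * hs
      · simp [hz]
  · rintro ⟨r, h₁, h₂⟩
    have he : IsIdempotentElem ((p : R) * r) := by
      change (p : R) * r * (p * r) = p * r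
      linear_combination (p : R) * h₁
    have hu : IsUnit (Int.castRingHom (R ⧸ Ideal.span {1 - (p : R) * r}) (p : ℤ)) := by
      refine IsUnit.of_mul_eq_one (Ideal.Quotient.mk _ r) ?_
      have h : Ideal.Quotient.mk (Ideal.span {1 - (p : R) * r}) (1 - p * r) = 0 :=
        Ideal.Quotient.eq_zero_iff_mem.mpr (Ideal.mem_span_singleton_self _)
      rw [map_sub, map_one, map_mul, map_natCast, sub_eq_zero] at h
      simpa using h.symm
    have hz : ((p ^ a : ℕ) : R ⧸ Ideal.span {(p : R) * r}) = 0 := by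
      rw [← map_natCast (Ideal.Quotient.mk _), Ideal.Quotient.eq_zero_iff_mem,
        Ideal.mem_span_singleton]
      refine ⟨(p : R) ^ a, ?_⟩
      push_cast
      linear_combination -h₂
    obtain ⟨g⟩ := ZMod.nonempty_ringHom_of_natCast_eq_zero hz
    exact he.nonempty_prod_ringHom (IsLocalization.Away.lift (p : ℤ) hu) g
end

section
/- For every prime p and every nonnegative integer a, the ring ℤ[1/p] × ℤ/p^aℤ is solid: for every commutative ring S there exists at most one ring homomorphism ℤ[1/p] × ℤ/p^aℤ → S. -/
/-- The element `(1, 0)` of `ℤ[1/p] × R` is divisible by every power of `p`. -/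
lemma exists_natCast_pow_mul_eq_one_zero (p k : ℕ) (R : Type*) [CommRing R] :
    ∃ u : Localization.Away (p : ℤ) × R, (p : Localization.Away (p : ℤ) × R) ^ k * u = (1, 0) := by
  refine ⟨(IsLocalization.Away.invSelf (p : ℤ) ^ k, 0), Prod.ext ?_ (by simp)⟩
  have h := IsLocalization.Away.mul_invSelf (S := Localization.Away (p : ℤ)) (p : ℤ)
  rw [map_natCast] at h
  simp [← mul_pow, h]

lemma map_one_zero_eq_mul {p a : ℕ} {S : Type*} [CommRing S]
    (f g : (Localization.Away (p : ℤ) × ZMod (p ^ a)) →+* S) :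
    f (1, 0) = f (1, 0) * g (1, 0) := by
  obtain ⟨u, hu⟩ := exists_natCast_pow_mul_eq_one_zero p a (ZMod (p ^ a))
  have hg : (p : S) ^ a * g (0, 1) = 0 := by
    have h : (p : Localization.Away (p : ℤ) × ZMod (p ^ a)) ^ a * (0, 1) = 0 := by
      refine Prod.ext (by simp) ?_
      simpa only [Nat.cast_pow, Prod.snd_mul, Prod.pow_snd, Prod.snd_natCast, mul_one, Prod.snd_zero]
        using ZMod.natCast_self (p ^ a)
    simpa using congrArg g h
  have hf : (p : S) ^ a * f u = f (1, 0) := by simpa using congrArg f hu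
  have hsum : g (1, 0) + g (0, 1) = 1 := by
    rw [← map_add, Prod.mk_add_mk, add_zero, zero_add]
    exact map_one g
  linear_combination (-f (1, 0)) * hsum - g (0, 1) * hf + f u * hg

lemma map_one_zero_eq {p a : ℕ} {S : Type*} [CommRing S]
    (f g : (Localization.Away (p : ℤ) × ZMod (p ^ a)) →+* S) : f (1, 0) = g (1, 0) := by
  rw [map_one_zero_eq_mul f g, mul_comm, ← map_one_zero_eq_mul g f]

/-- For every prime `p` and every `a ≥ 0`, the ring `ℤ[1/p] × ℤ/p^aℤ` is solid:
for every commutative ring `S` there is at most one ring homomorphism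
`ℤ[1/p] × ℤ/p^aℤ → S`. -/
theorem basic_solid (p : ℕ) (hp : p.Prime) (a : ℕ) :
    ∀ (S : Type) [CommRing S]
      (f g : (Localization.Away (p : ℤ) × ZMod (p ^ a)) →+* S), f = g := by
  intro S _ f g
  have he := map_one_zero_eq f g
  ext ⟨x, y⟩
  obtain ⟨z, rfl⟩ := ZMod.intCast_surjective y
  obtain ⟨k, m, hm⟩ := IsLocalization.Away.surj (p : ℤ) x
  rw [map_natCast, eq_intCast] at hm
  obtain ⟨u, hu⟩ := exists_natCast_pow_mul_eq_one_zero p k (ZMod (p ^ a))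
  set e : Localization.Away (p : ℤ) × ZMod (p ^ a) := (1, 0) with e_def
  set w : Localization.Away (p : ℤ) × ZMod (p ^ a) := (x, (z : ZMod (p ^ a))) with w_def
  have hsplit : w = w * e + (z : Localization.Away (p : ℤ) × ZMod (p ^ a)) * (1 - e) := by
    refine Prod.ext ?_ ?_ <;> simp [e_def, w_def]
  have hclear : (p : Localization.Away (p : ℤ) × ZMod (p ^ a)) ^ k * (w * e) = m * e := by
    refine Prod.ext ?_ ?_
    · simpa [e_def, w_def, mul_comm] using hm
    · simp [e_def]
  have hidem : f e * f e = f e := (map_one_zero_eq_mul f f).symm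
  have hf := congrArg f hclear
  have hg := congrArg g hclear
  have hu' := congrArg f hu
  have hsf := congrArg f hsplit
  have hsg := congrArg g hsplit
  simp only [map_mul, map_pow, map_natCast, map_intCast, map_add, map_sub, map_one, ← he]
    at hf hg hu' hsf hsg
  linear_combination hsf - hsg - (f w - g w) * hidem + f u * (hf - hg) - (f w - g w) * f e * hu'
end

section
/- Let p be a prime and a, b nonnegative integers. There exists a ring homomorphism ℤ[1/p] × ℤ/p^aℤ → ℤ[1/p] × ℤ/p^bℤ if and only if b ≤ a; moreover, when it exists, this homomorphism is surjective. -/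
/-- If `ℤ[1/p] × R` maps to `ZMod (p ^ b)` and `p ^ a = 0` in `R`, then `b ≤ a`. -/
theorem le_of_awayProd_hom_zmod {p : ℕ} (hp : p.Prime) {a b : ℕ} {R : Type*} [CommRing R]
    (hR : (p : R) ^ a = 0) (f : (Localization.Away (p : ℤ) × R) →+* ZMod (p ^ b)) : b ≤ a := by
  obtain ⟨s, hs⟩ := isUnit_iff_exists_inv.1
    (IsLocalization.Away.algebraMap_isUnit (S := Localization.Away (p : ℤ)) (p : ℤ))
  rw [map_natCast] at hs
  have key : ((p : ℕ) : Localization.Away (p : ℤ) × R) ^ a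
      = ((p : ℕ) : Localization.Away (p : ℤ) × R) ^ (a + 1) * (s, 0) := by
    ext
    · simp [pow_succ, mul_assoc, hs]
    · simp [hR]
  have h := congrArg f key
  simp only [map_mul, map_pow, map_natCast] at h
  have hnil : IsNilpotent ((p : ZMod (p ^ b)) * f (s, 0)) :=
    ⟨b, by rw [mul_pow, ← Nat.cast_pow, ZMod.natCast_self, zero_mul]⟩
  have hzero : (p : ZMod (p ^ b)) ^ a = 0 := by
    refine (hnil.isUnit_one_sub.mul_left_eq_zero).1 ?_
    linear_combination h
  rw [← Nat.cast_pow, ZMod.natCast_eq_zero_iff] at hzero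
  exact (Nat.pow_dvd_pow_iff_le_right hp.one_lt).1 hzero

/-- A ring homomorphism `ℤ[1/p] × R → ℤ[1/p] × ZMod (p ^ b)` fixes the idempotent `(1, 0)`
as soon as `p` is nilpotent in `R`. -/
theorem awayProd_hom_apply_one_zero {p a b : ℕ} {R : Type*} [CommRing R]
    (hR : (p : R) ^ a = 0)
    (f : (Localization.Away (p : ℤ) × R) →+* (Localization.Away (p : ℤ) × ZMod (p ^ b))) :
    f (1, 0) = (1, 0) := by
  have hu : IsUnit (p : Localization.Away (p : ℤ)) := by
    simpa using IsLocalization.Away.algebraMap_isUnit (S := Localization.Away (p : ℤ)) (p : ℤ)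
  obtain ⟨s, hs⟩ := isUnit_iff_exists_inv.1 (hu.pow b)
  ext
  · have h : ((p : ℕ) : Localization.Away (p : ℤ) × R) ^ a * (1, 0)
        = ((p : ℕ) : Localization.Away (p : ℤ) × R) ^ a := by
      ext <;> simp [hR]
    have h' := congrArg (fun x => (f x).1) h
    simp only [map_mul, map_pow, map_natCast, Prod.fst_mul, Prod.pow_fst, Prod.fst_natCast] at h'
    exact (hu.pow a).mul_left_cancel (by rw [h', mul_one])
  · have h : ((1, 0) : Localization.Away (p : ℤ) × R)
        = ((p : ℕ) : Localization.Away (p : ℤ) × R) ^ b * (s, 0) := by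
      ext <;> simp [hs]
    rw [h, map_mul, map_pow, map_natCast, Prod.snd_mul, Prod.pow_snd, Prod.snd_natCast,
      ← Nat.cast_pow, ZMod.natCast_self, zero_mul]

/-- A ring homomorphism `ℤ[1/p] × R → ℤ[1/p] × ZMod (p ^ b)` is surjective as soon as `p` is
nilpotent in `R`. -/
theorem awayProd_hom_surjective {p a b : ℕ} {R : Type*} [CommRing R] (hR : (p : R) ^ a = 0)
    (f : (Localization.Away (p : ℤ) × R) →+* (Localization.Away (p : ℤ) × ZMod (p ^ b))) :
    Function.Surjective f := by
  have h10 := awayProd_hom_apply_one_zero hR f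
  have hu : IsUnit (p : Localization.Away (p : ℤ)) := by
    simpa using IsLocalization.Away.algebraMap_isUnit (S := Localization.Away (p : ℤ)) (p : ℤ)
  rintro ⟨x, y⟩
  obtain ⟨k, n, hk⟩ := IsLocalization.Away.surj (p : ℤ) x
  obtain ⟨m, rfl⟩ := ZMod.intCast_surjective y
  simp only [map_natCast, eq_intCast] at hk
  refine ⟨(x, 0) + (m : Localization.Away (p : ℤ) × R) * (1 - (1, 0)), ?_⟩
  have hx : f (x, 0) = (x, 0) := by
    have h1 : ((x, 0) : Localization.Away (p : ℤ) × R) = (x, 0) * (1, 0) := by simp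
    have h2 : ((x, 0) : Localization.Away (p : ℤ) × R)
          * (p : Localization.Away (p : ℤ) × R) ^ k
        = (n : Localization.Away (p : ℤ) × R) * (1, 0) := by
      ext <;> simp [hk]
    ext
    · have h := congrArg (fun z => (f z).1) h2
      simp only [map_mul, map_pow, map_natCast, map_intCast, h10, Prod.fst_mul, Prod.pow_fst,
        Prod.fst_natCast, Prod.fst_intCast, mul_one] at h
      exact (hu.pow k).mul_right_cancel (by rw [h, hk])
    · rw [h1, map_mul, h10]
      simp
  rw [map_add, map_mul, map_sub, map_one, map_intCast, h10, hx]
  ext <;> simp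

/-- For a prime `p` and `a, b ≥ 0`, there exists a ring homomorphism
`ℤ[1/p] × ℤ/p^aℤ → ℤ[1/p] × ℤ/p^bℤ` if and only if `b ≤ a`; moreover any such homomorphism
is surjective. -/
theorem basic_hom_iff_le_and_surjective (p : ℕ) (hp : p.Prime) (a b : ℕ) :
    (Nonempty ((Localization.Away (p : ℤ) × ZMod (p ^ a)) →+*
        (Localization.Away (p : ℤ) × ZMod (p ^ b))) ↔ b ≤ a) ∧
      ∀ f : (Localization.Away (p : ℤ) × ZMod (p ^ a)) →+*
          (Localization.Away (p : ℤ) × ZMod (p ^ b)), Function.Surjective f := by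
  have hR : (p : ZMod (p ^ a)) ^ a = 0 := by rw [← Nat.cast_pow, ZMod.natCast_self]
  refine ⟨⟨fun ⟨f⟩ => le_of_awayProd_hom_zmod hp hR ((RingHom.snd _ _).comp f), fun h => ?_⟩,
    awayProd_hom_surjective hR⟩
  exact ⟨(RingHom.id _).prodMap (ZMod.castHom (pow_dvd_pow p h) _)⟩
end

section
/- Let R be a commutative ring of nonzero characteristic c, p a prime, and a a nonnegative integer. There exists a ring homomorphism ℤ[1/p] × ℤ/p^aℤ → R if and only if a ≥ v_p(c), where v_p(c) is the exponent of p in the prime factorization of c. -/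
/-- If `m` is prime to `p` and `v ≤ a`, then `ℤ[1/p] × ℤ/p^aℤ` maps to every ring in which
`p ^ v * m` vanishes. -/
theorem nonempty_basic_hom_of_coprime {R : Type*} [CommRing R] {p v m a : ℕ}
    [CharP R (p ^ v * m)] (hm : p.Coprime m) (hva : v ≤ a) :
    Nonempty ((Localization.Away (p : ℤ) × ZMod (p ^ a)) →+* R) := by
  have hu : IsUnit (Int.castRingHom (ZMod m) (p : ℤ)) := by
    simpa using (ZMod.isUnit_iff_coprime p m).2 hm
  let g : Localization.Away (p : ℤ) →+* ZMod m := IsLocalization.Away.lift (p : ℤ) hu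
  let h : ZMod (p ^ a) →+* ZMod (p ^ v) := ZMod.castHom (pow_dvd_pow p hva) _
  let e := ZMod.chineseRemainder (hm.pow_left v)
  exact ⟨((ZMod.castHom dvd_rfl R).comp (e.symm : _ →+* ZMod (p ^ v * m))).comp
    ((h.comp (RingHom.snd _ _)).prod (g.comp (RingHom.fst _ _)))⟩

/-- Given a ring homomorphism `ℤ[1/p] × ℤ/p^aℤ → R`, any power of `p` beyond the `a`-th can be
cancelled from an integer relation in `R`. -/
theorem natCast_eq_zero_of_basic_hom {R : Type*} [CommRing R] {p a : ℕ}
    (f : (Localization.Away (p : ℤ) × ZMod (p ^ a)) →+* R) {k m : ℕ}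
    (h : ((p ^ (a + k) * m : ℕ) : R) = 0) : ((p ^ a * m : ℕ) : R) = 0 := by
  obtain ⟨u, hu⟩ : ∃ u : Localization.Away (p : ℤ), (p : Localization.Away (p : ℤ)) ^ k * u = 1 :=
    IsUnit.exists_right_inv <| by
      simpa using (IsLocalization.Away.algebraMap_isUnit (S := Localization.Away (p : ℤ))
        (p : ℤ)).pow k
  have hz : (p : ZMod (p ^ a)) ^ a = 0 := by
    exact_mod_cast ZMod.natCast_self (p ^ a)
  have key : ((p ^ a * m : ℕ) : Localization.Away (p : ℤ) × ZMod (p ^ a)) =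
      ((p ^ (a + k) * m : ℕ) : Localization.Away (p : ℤ) × ZMod (p ^ a)) * (u, 0) := by
    ext
    · simp only [Prod.fst_mul, Prod.fst_natCast]
      push_cast
      linear_combination (-(p : Localization.Away (p : ℤ)) ^ a * m) * hu
    · simp [hz]
  rw [← map_natCast f, key, map_mul, map_natCast, h, zero_mul]

/-- Let `R` be a commutative ring of nonzero characteristic `c`, `p` a prime and
`a ≥ 0`. There exists a ring homomorphism `ℤ[1/p] × ℤ/p^aℤ → R` if and only if
`a ≥ v_p(c)`, the `p`-adic valuation of `c`. -/
theorem exists_basic_hom_iff_padicValNat_le (R : Type) [CommRing R] (hc : ringChar R ≠ 0)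
    (p : ℕ) (hp : p.Prime) (a : ℕ) :
    Nonempty ((Localization.Away (p : ℤ) × ZMod (p ^ a)) →+* R) ↔
      padicValNat p (ringChar R) ≤ a := by
  obtain ⟨v, m, hpm, hcm⟩ := Nat.exists_eq_pow_mul_and_not_dvd hc p hp.ne_one
  have : Fact p.Prime := ⟨hp⟩
  have hm : m ≠ 0 := by rintro rfl; simp at hpm
  have hv : padicValNat p (ringChar R) = v := by
    rw [hcm, padicValNat.mul (pow_ne_zero _ hp.ne_zero) hm, padicValNat.prime_pow,
      padicValNat.eq_zero_of_not_dvd hpm, add_zero]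
  have hchar : CharP R (p ^ v * m) := hcm ▸ ringChar.charP R
  rw [hv]
  refine ⟨fun ⟨f⟩ ↦ ?_, nonempty_basic_hom_of_coprime ((Nat.Prime.coprime_iff_not_dvd hp).2 hpm)⟩
  by_contra! hlt
  obtain ⟨k, rfl⟩ := Nat.exists_eq_add_of_le hlt.le
  have hdvd := (CharP.cast_eq_zero_iff R _ _).1
    (natCast_eq_zero_of_basic_hom f (CharP.cast_eq_zero R (p ^ (a + k) * m)))
  have := (Nat.pow_dvd_pow_iff_le_right hp.one_lt).1
    (Nat.dvd_of_mul_dvd_mul_right (Nat.pos_of_ne_zero hm) hdvd)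
  omega
end

section
/- Let R be a commutative ring of nonzero characteristic c. Then the core of R (the subring of absolute elements) is exactly the prime subring of R, i.e., the image of the unique ring homomorphism ℤ → R; in particular the core of R is isomorphic to ℤ/cℤ. -/
open scoped TensorProduct

/-- A point of the circle killed by `n` comes from `ZMod n`. -/
lemma ZMod.exists_toAddCircle_eq_of_nsmul_eq_zero {n : ℕ} [NeZero n] {u : UnitAddCircle}
    (hu : n • u = 0) : ∃ j : ZMod n, ZMod.toAddCircle j = u := by
  obtain ⟨m, -, hm⟩ := (AddCircle.nsmul_eq_zero_iff (NeZero.pos n)).mp hu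
  exact ⟨m, by rw [ZMod.toAddCircle_natCast, ← hm, mul_one]⟩

/-- A ring of characteristic `n ≠ 0` retracts additively onto its prime subring: this is the
self-injectivity of `ZMod n`, deduced from the divisibility of the circle. -/
lemma CharP.exists_addMonoidHom_zmod_map_one (R : Type*) [CommRing R] (n : ℕ) [NeZero n]
    [CharP R n] : ∃ P : R →+ ZMod n, P 1 = 1 := by
  obtain ⟨r, hr⟩ := (Module.Baer.of_divisible UnitAddCircle).extension_property_addMonoidHom
    (ZMod.castHom dvd_rfl R).toAddMonoidHom (ZMod.castHom_injective R) (ZMod.toAddCircle (N := n))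
  have hrange (x : R) : r x ∈ (ZMod.toAddCircle (N := n)).range :=
    ZMod.exists_toAddCircle_eq_of_nsmul_eq_zero <| by
      rw [← map_nsmul, nsmul_eq_mul, CharP.cast_eq_zero, zero_mul, map_zero]
  let e := AddMonoidHom.ofInjective (ZMod.toAddCircle_injective n)
  refine ⟨e.symm.toAddMonoidHom.comp (r.codRestrict _ hrange), ?_⟩
  refine (AddEquiv.symm_apply_eq e).mpr (Subtype.ext ?_)
  simpa [e, AddMonoidHom.ofInjective_apply] using DFunLike.congr_fun hr 1

/-- In nonzero characteristic, an element equalised by the two inclusions of `R` into `R ⊗ R` lies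
in the prime subring. -/
lemma CharP.mem_range_intCast_of_tmul_one_eq {R : Type*} [CommRing R] (n : ℕ) [NeZero n]
    [CharP R n] {x : R} (hx : x ⊗ₜ[ℤ] (1 : R) = 1 ⊗ₜ[ℤ] x) : x ∈ (Int.castRingHom R).range := by
  obtain ⟨P, hP⟩ := CharP.exists_addMonoidHom_zmod_map_one R n
  let Q : R →+ R := (ZMod.castHom dvd_rfl R).toAddMonoidHom.comp P
  have h := congrArg (TensorProduct.lift ((LinearMap.mul ℤ R).comp Q.toIntLinearMap)) hx
  have hxP : ZMod.castHom dvd_rfl R (P x) = x := by simpa [Q, hP] using h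
  obtain ⟨m, hm⟩ := ZMod.intCast_surjective (P x)
  exact ⟨m, by rw [← hxP, ← hm, map_intCast, eq_intCast]⟩

/-- The prime subring of a ring of characteristic `n` is isomorphic to `ZMod n`. -/
noncomputable def CharP.intCastRangeEquivZMod (R : Type*) [CommRing R] (n : ℕ) [CharP R n] :
    (Int.castRingHom R).range ≃+* ZMod n :=
  (RingEquiv.subringCongr (by
    ext x
    constructor
    · rintro ⟨m, rfl⟩
      exact ⟨m, by simp⟩
    · rintro ⟨j, rfl⟩
      obtain ⟨m, rfl⟩ := ZMod.intCast_surjective j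
      exact ⟨m, by simp⟩)).trans
    (RingEquiv.ofBijective _ ⟨fun _ _ h => ZMod.castHom_injective R (congrArg Subtype.val h),
      (ZMod.castHom dvd_rfl R).rangeRestrict_surjective⟩).symm


/-- Let `R` be a commutative ring of nonzero characteristic `c`. Then the core of
`R` (the set of absolute elements) is exactly the prime subring of `R`, i.e. the range of the
unique ring homomorphism `ℤ → R`; in particular the core is isomorphic to `ℤ/cℤ`. -/
theorem core_eq_prime_subring_of_char_ne_zero (R : Type) [CommRing R] (hc : ringChar R ≠ 0) :
    (∀ x : R, (∀ (S : Type) [CommRing S] (f g : R →+* S), f x = g x) ↔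
        x ∈ (Int.castRingHom R).range) ∧
      Nonempty ((Int.castRingHom R).range ≃+* ZMod (ringChar R)) := by
  have : NeZero (ringChar R) := ⟨hc⟩
  refine ⟨fun x => ⟨fun h => ?_, ?_⟩, ⟨CharP.intCastRangeEquivZMod R (ringChar R)⟩⟩
  · exact CharP.mem_range_intCast_of_tmul_one_eq (ringChar R) <|
      h (R ⊗[ℤ] R) Algebra.TensorProduct.includeLeftRingHom
        (Algebra.TensorProduct.includeRight : R →ₐ[ℤ] R ⊗[ℤ] R).toRingHom
  · rintro ⟨m, rfl⟩ S _ f g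
    simp
end

section
/- Every solid commutative ring of nonzero characteristic c is isomorphic to the cyclic ring ℤ/cℤ. -/
open scoped TensorProduct in
/-- If the two coprojections of a nontrivial algebra `K` over a field `k` into `K ⊗ K` agree at `a`,
then `a` is a scalar. -/
theorem exists_algebraMap_eq_of_one_tmul_eq {k K : Type*} [Field k] [CommRing K] [Algebra k K]
    [Nontrivial K] {a : K} (h : (1 : K) ⊗ₜ[k] a = a ⊗ₜ[k] 1) : ∃ r : k, algebraMap k K r = a := by
  obtain ⟨φ, hφ⟩ := (Algebra.linearMap k K).exists_leftInverse_of_injective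
    (LinearMap.ker_eq_bot.mpr (algebraMap k K).injective)
  have h₁ : φ 1 = 1 := by simpa using LinearMap.congr_fun hφ 1
  refine ⟨φ a, ?_⟩
  have := congrArg (fun t => TensorProduct.lid k K (φ.rTensor K t)) h
  simpa [h₁, Algebra.smul_def, eq_comm] using this

/-- A solid ring is generated, modulo any prime number, by the image of the integers. -/
theorem exists_intCast_add_prime_mul_of_solid (R : Type) [CommRing R]
    (hsolid : ∀ (S : Type) [CommRing S] (f g : R →+* S), f = g) {p : ℕ} (hp : p.Prime) (x : R) :
    ∃ (k : ℤ) (y : R), x = k + p * y := by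
  let I : Ideal R := Ideal.span {(p : R)}
  suffices h : ∃ k : ℤ, x - k ∈ I by
    obtain ⟨k, hk⟩ := h
    obtain ⟨y, hy⟩ := Ideal.mem_span_singleton'.mp hk
    exact ⟨k, y, by linear_combination -hy⟩
  obtain hK | hK := subsingleton_or_nontrivial (R ⧸ I)
  · exact ⟨0, Ideal.Quotient.eq_zero_iff_mem.mp (Subsingleton.elim _ _)⟩
  have : Fact p.Prime := ⟨hp⟩
  have : CharP (R ⧸ I) p := by
    refine (CharP.charP_iff_prime_eq_zero hp).mpr ?_
    rw [← map_natCast (Ideal.Quotient.mk I)]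
    exact Ideal.Quotient.eq_zero_iff_mem.mpr (Ideal.mem_span_singleton_self _)
  let _ : Algebra (ZMod p) (R ⧸ I) := ZMod.algebra _ p
  have h := RingHom.congr_fun (hsolid (TensorProduct (ZMod p) (R ⧸ I) (R ⧸ I))
    ((Algebra.TensorProduct.includeRight (R := ZMod p) (A := R ⧸ I) (B := R ⧸ I)).toRingHom.comp
      (Ideal.Quotient.mk I))
    (Algebra.TensorProduct.includeLeftRingHom.comp (Ideal.Quotient.mk I))) x
  obtain ⟨r, hr⟩ := exists_algebraMap_eq_of_one_tmul_eq (k := ZMod p) h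
  obtain ⟨k, rfl⟩ := ZMod.intCast_surjective r
  refine ⟨k, Ideal.Quotient.eq.mp ?_⟩
  rw [← hr]
  simp

/-- A solid ring is generated, modulo any positive integer, by the image of the integers. -/
theorem exists_intCast_add_mul_of_solid (R : Type) [CommRing R]
    (hsolid : ∀ (S : Type) [CommRing S] (f g : R →+* S), f = g) {n : ℕ} (hn : n ≠ 0) (x : R) :
    ∃ (k : ℤ) (y : R), x = k + n * y := by
  induction n using induction_on_primes generalizing x with
  | zero => exact absurd rfl hn
  | one => exact ⟨0, x, by simp⟩
  | prime_mul p m hp ih =>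
    obtain ⟨k, y, rfl⟩ := ih (right_ne_zero_of_mul hn) x
    obtain ⟨l, z, rfl⟩ := exists_intCast_add_prime_mul_of_solid R hsolid hp y
    exact ⟨k + m * l, z, by push_cast; ring⟩

/-- Every solid commutative ring of nonzero characteristic `c` is isomorphic to
the cyclic ring `ℤ/cℤ`. -/
theorem solid_char_ne_zero_iso_zmod (R : Type) [CommRing R]
    (hsolid : ∀ (S : Type) [CommRing S] (f g : R →+* S), f = g)
    (hc : ringChar R ≠ 0) :
    Nonempty (R ≃+* ZMod (ringChar R)) := by
  refine ⟨(RingEquiv.ofBijective (ZMod.castHom dvd_rfl R)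
    ⟨ZMod.castHom_injective R, fun x => ?_⟩).symm⟩
  obtain ⟨k, y, rfl⟩ := exists_intCast_add_mul_of_solid R hsolid hc x
  exact ⟨k, by simp⟩
end

section
/- Let R be a commutative ring of characteristic zero, p a prime, and a a nonnegative integer, and suppose there exists a ring homomorphism ℤ[1/p] × ℤ/p^aℤ → R. Then there exists a nonnegative integer b ≤ a and an injective ring homomorphism ℤ[1/p] × ℤ/p^bℤ → R. -/
/-- A ring homomorphism from `ℤ[1/p] × S` to a ring of characteristic zero is injective on the
first factor as soon as some nonzero integer annihilates `S`. -/
theorem eq_zero_of_map_prod_zero_eq_zero {R S : Type*} [CommRing R] [CharZero R] [CommRing S]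
    {p n : ℕ} (hn : n ≠ 0) (hS : (n : S) = 0) (g : Localization.Away (p : ℤ) × S →+* R)
    {x : Localization.Away (p : ℤ)} (hx : g (x, 0) = 0) : x = 0 := by
  obtain ⟨⟨m, s⟩, hms⟩ := IsLocalization.surj (Submonoid.powers (p : ℤ)) x
  have hm : g ((m : Localization.Away (p : ℤ)), 0) = 0 := by
    have h : ((m : Localization.Away (p : ℤ)), (0 : S)) =
        (x, 0) * (algebraMap ℤ (Localization.Away (p : ℤ)) s, 0) := by
      simpa using hms.symm
    rw [h, map_mul, hx, zero_mul]
  have hm' : ((n * m : ℤ) : R) = 0 := by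
    have h : ((n * m : ℤ) : Localization.Away (p : ℤ) × S) =
        (n : Localization.Away (p : ℤ) × S) * ((m : Localization.Away (p : ℤ)), 0) := by
      ext <;> simp [hS]
    rw [← map_intCast g, h, map_mul, hm, mul_zero]
  have hm0 : m = 0 := by
    have h := Int.cast_eq_zero.mp hm'
    simpa [hn] using h
  have hu := IsLocalization.map_units (Localization.Away (p : ℤ)) s
  rw [hm0, map_zero] at hms
  exact hu.mul_left_eq_zero.mp hms

/-- Let `R` be a commutative ring of characteristic zero, `p` a prime and `a ≥ 0`,
and suppose there exists a ring homomorphism `ℤ[1/p] × ℤ/p^aℤ → R`. Then there is some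
`b ≤ a` and an injective ring homomorphism `ℤ[1/p] × ℤ/p^bℤ → R`. -/
theorem exists_injective_basic_hom (R : Type) [CommRing R] [CharZero R]
    (p : ℕ) (hp : p.Prime) (a : ℕ)
    (h : Nonempty ((Localization.Away (p : ℤ) × ZMod (p ^ a)) →+* R)) :
    ∃ b ≤ a, ∃ f : (Localization.Away (p : ℤ) × ZMod (p ^ b)) →+* R,
      Function.Injective f := by
  obtain ⟨g⟩ := h
  have hcast (m : ℤ) : g (0, (m : ZMod (p ^ a))) = m • g (0, 1) := by
    rw [← map_zsmul]
    simp
  have hord : addOrderOf (g (0, 1)) ∣ p ^ a := by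
    rw [addOrderOf_dvd_iff_nsmul_eq_zero, ← map_nsmul, Prod.smul_mk, nsmul_one,
      ZMod.natCast_self, nsmul_zero, Prod.mk_zero_zero, map_zero]
  obtain ⟨b, hba, hb⟩ := (Nat.dvd_prime_pow hp).mp hord
  let π : Localization.Away (p : ℤ) × ZMod (p ^ a) →+* Localization.Away (p : ℤ) × ZMod (p ^ b) :=
    (RingHom.id _).prodMap (ZMod.castHom (pow_dvd_pow p hba) _)
  have hπ : Function.Surjective π :=
    Function.surjective_id.prodMap (ZMod.ringHom_surjective (ZMod.castHom (pow_dvd_pow p hba) _))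
  have hsnd (y : ZMod (p ^ a)) :
      g (0, y) = 0 ↔ ZMod.castHom (pow_dvd_pow p hba) (ZMod (p ^ b)) y = 0 := by
    obtain ⟨m, rfl⟩ := ZMod.intCast_surjective y
    rw [hcast, ← addOrderOf_dvd_iff_zsmul_eq_zero, hb, map_intCast, ZMod.intCast_zmod_eq_zero_iff_dvd]
  have hker (w) : g w = 0 ↔ π w = 0 := by
    obtain ⟨x, y⟩ := w
    constructor
    · intro hw
      have hx : g (x, 0) = 0 := by
        rw [show (x, (0 : ZMod (p ^ a))) = (x, y) * (1, 0) by simp, map_mul, hw, zero_mul]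
      have hy : g (0, y) = 0 := by
        rw [show ((0 : Localization.Away (p : ℤ)), y) = (x, y) * (0, 1) by simp, map_mul, hw,
          zero_mul]
      exact Prod.ext (eq_zero_of_map_prod_zero_eq_zero (pow_ne_zero a hp.ne_zero)
        (ZMod.natCast_self _) g hx) ((hsnd y).mp hy)
    · intro hw
      obtain rfl : x = 0 := congrArg Prod.fst hw
      exact (hsnd y).mpr (congrArg Prod.snd hw)
  refine ⟨b, hba, π.liftOfSurjective hπ ⟨g, fun w hw => (hker w).mpr hw⟩, ?_⟩
  rw [injective_iff_map_eq_zero]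
  intro z hz
  obtain ⟨w, rfl⟩ := hπ z
  exact (hker w).mp ((π.liftOfRightInverse_comp_apply _ _ _ _).symm.trans hz)
end

section
/- Let K be a field of characteristic zero. Then the core of K (the subring of absolute elements of K) is exactly the image of the unique ring homomorphism ℚ → K; that is, an element x ∈ K is absolute if and only if x is a rational number (lies in the prime field ℚ ⊆ K). -/
/-- Let `K` be a field of characteristic zero. An element `x ∈ K` is absolute if
and only if `x` lies in the prime field `ℚ ⊆ K`, i.e. `x` is the image of a rational number
under the unique ring homomorphism `ℚ → K`. -/
theorem core_of_charZero_field (K : Type) [Field K] [CharZero K] (x : K) :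
    (∀ (S : Type) [CommRing S] (f g : K →+* S), f x = g x) ↔ ∃ q : ℚ, (q : K) = x := by
  constructor
  · intro h
    have hx := h (TensorProduct ℚ K K) Algebra.TensorProduct.includeLeftRingHom
      (Algebra.TensorProduct.includeRight : K →ₐ[ℚ] TensorProduct ℚ K K).toRingHom
    exact (Algebra.IsEffective.of_faithfullyFlat ℚ K x).mp (sub_eq_zero.mpr hx)
  · rintro ⟨q, rfl⟩ S _ f g
    exact DFunLike.congr_fun
      (Subsingleton.elim (f.comp (Rat.castHom K)) (g.comp (Rat.castHom K))) q
end

section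
/- Let p be a prime and ℤ_p the ring of p-adic integers. An element x ∈ ℤ_p is absolute if and only if there exist integers a, b with p not dividing b such that b·x = a in ℤ_p; that is, the core of ℤ_p is the subring ℤ_(p), the localization of ℤ at the prime ideal (p), viewed inside ℤ_p. -/
open scoped TensorProduct in
/-- Over a field, `x ⊗ 1 = 1 ⊗ x` forces `x` to be a scalar. -/
theorem mem_range_algebraMap_of_tmul_one_eq_one_tmul {k A : Type*} [Field k] [CommRing A]
    [Nontrivial A] [Algebra k A] {x : A} (h : x ⊗ₜ[k] (1 : A) = (1 : A) ⊗ₜ[k] x) :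
    x ∈ Set.range (algebraMap k A) := by
  by_contra hx
  have hx' : x ∉ Submodule.span k {(1 : A)} := by
    rw [Submodule.mem_span_singleton]
    rintro ⟨q, rfl⟩
    exact hx ⟨q, Algebra.algebraMap_eq_smul_one q⟩
  obtain ⟨φ, hφx, hφ⟩ := Submodule.exists_le_ker_of_notMem hx'
  have hφ1 : φ 1 = 0 := hφ (Submodule.mem_span_singleton_self 1)
  have := congrArg (fun t => TensorProduct.lid k A (φ.rTensor A t)) h
  simp [hφ1, hφx] at this

/-- The integers prime to `p` are units of the `p`-adic integers. -/
theorem PadicInt.isUnit_intCast_of_not_dvd {p : ℕ} [Fact p.Prime] {b : ℤ} (hb : ¬ (p : ℤ) ∣ b) :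
    IsUnit (b : PadicInt p) := by
  rw [PadicInt.isUnit_iff]
  exact (PadicInt.norm_le_one _).antisymm
    (not_lt.mp (mt (PadicInt.norm_int_lt_one_iff_dvd b).mp hb))

/-- A `p`-adic integer that is rational has denominator prime to `p`. -/
theorem PadicInt.not_dvd_den_of_coe_eq_ratCast {p : ℕ} [Fact p.Prime] {x : PadicInt p} {q : ℚ}
    (h : (x : ℚ_[p]) = q) : ¬ (p : ℤ) ∣ (q.den : ℤ) ∧
      (((q.den : ℤ) : PadicInt p)) * x = ((q.num : ℤ) : PadicInt p) := by
  have heq : (((q.den : ℤ) : PadicInt p)) * x = ((q.num : ℤ) : PadicInt p) := by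
    apply PadicInt.ext
    push_cast
    rw [h]
    exact_mod_cast Rat.den_mul_eq_num q
  refine ⟨fun hd => ?_, heq⟩
  have hn : (p : ℤ) ∣ q.num := by
    rw [← PadicInt.norm_int_lt_one_iff_dvd, ← heq, norm_mul]
    exact mul_lt_one_of_nonneg_of_lt_one_left (norm_nonneg _)
      ((PadicInt.norm_int_lt_one_iff_dvd _).mpr hd) (PadicInt.norm_le_one x)
  have hp := Nat.dvd_gcd (Int.natCast_dvd.mp hn) (Int.natCast_dvd_natCast.mp hd)
  rw [q.reduced.gcd_eq_one] at hp
  exact (Fact.out : p.Prime).one_lt.ne' (Nat.dvd_one.mp hp)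

/-- For a prime `p`, an element `x` of the `p`-adic integers `ℤ_p` is absolute if
and only if there are integers `a`, `b` with `p ∤ b` and `b * x = a` in `ℤ_p`; that is, the
core of `ℤ_p` is the localization `ℤ_(p)` viewed inside `ℤ_p`. -/
theorem core_padicInt (p : ℕ) [Fact p.Prime] (x : PadicInt p) :
    (∀ (S : Type) [CommRing S] (f g : PadicInt p →+* S), f x = g x) ↔
      ∃ a b : ℤ, ¬ (p : ℤ) ∣ b ∧ (b : PadicInt p) * x = (a : PadicInt p) := by
  constructor
  · intro h
    have hx := h (TensorProduct ℚ ℚ_[p] ℚ_[p])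
      ((Algebra.TensorProduct.includeLeft : ℚ_[p] →ₐ[ℚ] _).toRingHom.comp PadicInt.Coe.ringHom)
      ((Algebra.TensorProduct.includeRight : ℚ_[p] →ₐ[ℚ] _).toRingHom.comp PadicInt.Coe.ringHom)
    obtain ⟨q, hq⟩ := mem_range_algebraMap_of_tmul_one_eq_one_tmul (k := ℚ) (x := (x : ℚ_[p])) hx
    rw [eq_ratCast] at hq
    exact ⟨q.num, q.den, (PadicInt.not_dvd_den_of_coe_eq_ratCast hq.symm).imp_right (by simp)⟩
  · rintro ⟨a, b, hb, hab⟩ S _ f g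
    have hu : IsUnit (b : S) := by
      simpa using (PadicInt.isUnit_intCast_of_not_dvd hb).map f
    apply hu.mul_left_cancel
    have hf := congrArg f hab
    have hg := congrArg g hab
    simp only [map_mul, map_intCast] at hf hg
    rw [hf, hg]
end

section
/- Let Ẑ = ∏_p ℤ_p be the product of the rings of p-adic integers over all primes p (the profinite completion of ℤ). An element x ∈ Ẑ is absolute if and only if x lies in the image of the unique ring homomorphism ℤ → Ẑ; that is, the core of Ẑ is ℤ. -/
instance (p : Nat.Primes) : Fact (p : ℕ).Prime := ⟨p.2⟩

/-- If `x ⊗ 1 = 1 ⊗ x` in `A ⊗[K] A` for a nontrivial algebra `A` over a field `K`, then `x`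
is a scalar. -/
theorem exists_algebraMap_eq_of_tmul_one_eq_one_tmul {K A : Type*} [Field K] [CommRing A]
    [Algebra K A] [Nontrivial A] {x : A}
    (h : TensorProduct.tmul K x (1 : A) = TensorProduct.tmul K (1 : A) x) :
    ∃ q : K, algebraMap K A q = x := by
  obtain ⟨φ, hφ⟩ := (Algebra.linearMap K A).exists_leftInverse_of_injective
    (LinearMap.ker_eq_bot.2 (algebraMap K A).injective)
  have h_one : φ 1 = 1 := by simpa using LinearMap.congr_fun hφ 1
  refine ⟨φ x, ?_⟩
  have := congrArg (fun t => TensorProduct.lid K A (φ.rTensor A t)) h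
  simpa [h_one, Algebra.algebraMap_eq_smul_one] using this

/-- A rational number that is `p`-integral at every prime `p` is an integer. -/
theorem Rat.exists_intCast_eq_of_forall_padic_norm_le_one {q : ℚ}
    (h : ∀ p : Nat.Primes, ‖(q : ℚ_[p])‖ ≤ 1) : ∃ n : ℤ, (n : ℚ) = q := by
  refine ⟨q.num, Rat.coe_int_num_of_den_eq_one ?_⟩
  by_contra hden
  obtain ⟨p, hp, hpd⟩ := Nat.exists_prime_and_dvd hden
  have := Fact.mk hp
  refine PadicInt.isUnit_iff.1 (PadicInt.isUnit_den q (h ⟨p, hp⟩)) |>.not_lt ?_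
  exact_mod_cast (PadicInt.norm_int_lt_one_iff_dvd (q.den : ℤ)).2 (Int.natCast_dvd_natCast.2 hpd)

/-- Let `Ẑ = ∏_p ℤ_p` be the product of the rings of `p`-adic integers over all
primes `p`. An element `x ∈ Ẑ` is absolute if and only if `x` lies in the image of the unique
ring homomorphism `ℤ → Ẑ`; that is, the core of `Ẑ` is `ℤ`. -/
theorem core_profinite_completion (x : ∀ p : Nat.Primes, PadicInt p) :
    (∀ (S : Type) [CommRing S]
        (f g : (∀ p : Nat.Primes, PadicInt p) →+* S), f x = g x) ↔
      ∃ n : ℤ, (n : ∀ p : Nat.Primes, PadicInt p) = x := by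
  constructor
  · intro h
    let A := ∀ p : Nat.Primes, ℚ_[p]
    let ι : (∀ p : Nat.Primes, PadicInt p) →+* A :=
      RingHom.pi fun p => PadicInt.Coe.ringHom.comp (Pi.evalRingHom _ p)
    obtain ⟨q, hq⟩ := exists_algebraMap_eq_of_tmul_one_eq_one_tmul (K := ℚ) (x := ι x) <|
      h (TensorProduct ℚ A A)
        ((Algebra.TensorProduct.includeLeft : A →ₐ[ℚ] _).toRingHom.comp ι)
        ((Algebra.TensorProduct.includeRight : A →ₐ[ℚ] _).toRingHom.comp ι)
    have hx (p : Nat.Primes) : (q : ℚ_[p]) = x p := congrFun hq p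
    obtain ⟨n, rfl⟩ := Rat.exists_intCast_eq_of_forall_padic_norm_le_one (q := q)
      fun p => by rw [hx p]; exact (x p).2
    refine ⟨n, funext fun p => Subtype.ext ?_⟩
    simpa using hx p
  · rintro ⟨n, rfl⟩ S _ f g
    rw [map_intCast, map_intCast]
end

section
/- Let R be a commutative ring of characteristic zero and let R[{X_i}_{i∈I}] be a polynomial ring over R in an arbitrary collection of indeterminates. Then a polynomial F ∈ R[{X_i}] is absolute if and only if F is a constant polynomial whose constant coefficient is an absolute element of R; that is, the core of R[{X_i}] equals the core of R (embedded as constants). -/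
/-- Let `R` be a commutative ring of characteristic zero and `R[{X_i}_{i ∈ I}]` a
polynomial ring over `R` in an arbitrary collection of indeterminates. A polynomial `F` is
absolute if and only if `F` is a constant polynomial whose constant coefficient is an
absolute element of `R`; i.e. the core of `R[{X_i}]` is the core of `R`. -/
theorem core_mvPolynomial (R : Type) [CommRing R] [CharZero R] (I : Type)
    (F : MvPolynomial I R) :
    (∀ (S : Type) [CommRing S] (f g : MvPolynomial I R →+* S), f F = g F) ↔
      ∃ r : R, (∀ (S : Type) [CommRing S] (f g : R →+* S), f r = g r) ∧
        F = MvPolynomial.C r := by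
  constructor
  · intro hF
    refine ⟨MvPolynomial.eval 0 F, fun S _ f g => ?_, ?_⟩
    · exact hF S (f.comp (MvPolynomial.eval 0)) (g.comp (MvPolynomial.eval 0))
    · exact hF (MvPolynomial I R) (RingHom.id _) (MvPolynomial.C.comp (MvPolynomial.eval 0))
  · rintro ⟨r, hr, rfl⟩ S _ f g
    exact hr S (f.comp MvPolynomial.C) (g.comp MvPolynomial.C)
end
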